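/- For all n ∈ ℕ, the path graph P_n on n vertices satisfies gc(P_n) ≥ n − 1. -/

import Mathlib

open Matrix

def GCFeasible {V : Type*} [Fintype V] (A : Matrix V V ℝ) (m : ℕ) : Prop :=
  ∃ (k : ℕ) (P : Matrix (Fin k) V ℝ) (w : Fin k → ℝ),
    (∀ p i, P p i = 1 ∨ P p i = -1) ∧
    (∀ i, A i i = 0) ∧
    (∀ i j, i ≠ j → A i j = (Pᵀ * Matrix.diagonal w * P) i j) ∧
    m = (Finset.univ.filter fun p => w p ≠ 0).card

noncomputable def gc {V : Type*} [Fintype V] (A : Matrix V V ℝ) : ℕ :=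
  sInf { m | GCFeasible A m }

open scoped Classical in
noncomputable def gcGraph {V : Type*} [Fintype V] (G : SimpleGraph V) : ℕ :=
  gc (Matrix.of fun u v => if G.Adj u v then (1 : ℝ) else 0)

/-- The path graph P_n on n vertices, with edges {i, i+1}. -/
def pathGraphFin (n : ℕ) : SimpleGraph (Fin n) :=
  SimpleGraph.fromRel fun u v => u.val + 1 = v.val

theorem GCFeasible.of_fintype {V ι : Type*} [Fintype V] [Fintype ι]
    {A : Matrix V V ℝ} (P : Matrix ι V ℝ) (w : ι → ℝ) (hP : ∀ p i, P p i = 1 ∨ P p i = -1)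
    (hd : ∀ i, A i i = 0) (hA : ∀ i j, i ≠ j → A i j = ∑ p, P p i * w p * P p j) :
    ∃ m, GCFeasible A m := by
  let e := Fintype.equivFin ι
  refine ⟨_, Fintype.card ι, P.submatrix e.symm id, fun p => w (e.symm p),
    fun p i => hP _ i, hd, fun i j hij => ?_, rfl⟩
  rw [hA i j hij, Matrix.mul_apply]
  simp only [Matrix.mul_diagonal, Matrix.transpose_apply, Matrix.submatrix_apply, id_eq]
  exact (e.symm.sum_comp fun p => P p i * w p * P p j).symm

/-- Every symmetric matrix with zero diagonal has a coupling. -/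
theorem exists_gcFeasible {V : Type*} [Fintype V] [DecidableEq V] {A : Matrix V V ℝ}
    (hs : A.IsSymm) (hd : ∀ i, A i i = 0) : ∃ m, GCFeasible A m := by
  let r : Bool → V → V → ℝ := fun s a i => if s ∧ i = a then -1 else 1
  have hr : ∀ s a i, r s a i = 1 ∨ r s a i = -1 := by
    intro s a i
    simp only [r]
    split_ifs <;> simp
  let ε : Bool → ℝ := fun s => if s then -1 else 1
  refine GCFeasible.of_fintype (ι := V × V × Bool × Bool)
    (fun p i => r p.2.2.1 p.1 i * r p.2.2.2 p.2.1 i)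
    (fun p => A p.1 p.2.1 / 8 * ε p.2.2.1 * ε p.2.2.2) ?_ hd ?_
  · rintro ⟨a, b, s, t⟩ i
    rcases hr s a i with h | h <;> rcases hr t b i with h' | h' <;> simp [h, h']
  · intro i j hij
    have key : ∀ a b, (∑ x : Bool × Bool, r x.1 a i * r x.2 b i *
        (A a b / 8 * ε x.1 * ε x.2) * (r x.1 a j * r x.2 b j)) =
        (if i = a then if j = b then A a b / 2 else 0 else 0) +
        (if j = a then if i = b then A a b / 2 else 0 else 0) := by
      intro a b
      simp only [Fintype.sum_prod_type, Fintype.sum_bool, r, ε]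
      by_cases h1 : i = a <;> by_cases h2 : j = b <;> by_cases h3 : j = a <;>
        by_cases h4 : i = b <;> simp_all <;> ring
    simp only [Fintype.sum_prod_type] at key ⊢
    simp only [key, Finset.sum_add_distrib]
    simp [hs.apply i j]

/-- A coupling determines a completion of the diagonal of `A` by a constant, of rank at most the
number of nonzero weights. -/
theorem GCFeasible.exists_rank_le {V : Type*} [Fintype V] [DecidableEq V] {A : Matrix V V ℝ}
    {m : ℕ} (h : GCFeasible A m) : ∃ d : ℝ, (A + d • (1 : Matrix V V ℝ)).rank ≤ m := by
  obtain ⟨k, P, w, hP, hd, hA, rfl⟩ := h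
  refine ⟨∑ p, w p, ?_⟩
  have hM : A + (∑ p, w p) • (1 : Matrix V V ℝ) = Pᵀ * Matrix.diagonal w * P := by
    ext i j
    by_cases hij : i = j
    · subst hij
      rw [Matrix.mul_apply]
      simp only [Matrix.add_apply, hd, Matrix.smul_apply, Matrix.one_apply_eq, smul_eq_mul,
        mul_one, zero_add, Matrix.mul_diagonal, Matrix.transpose_apply]
      refine Finset.sum_congr rfl fun p _ => ?_
      rcases hP p i with h | h <;> simp [h]
    · simp [hij, ← hA i j hij]
  rw [hM]
  refine ((Matrix.rank_mul_le_left _ _).trans (Matrix.rank_mul_le_right _ _)).trans ?_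
  rw [Matrix.rank_diagonal, Fintype.card_subtype]

theorem le_rank_of_submatrix_lowerTriangular {n : ℕ} (M : Matrix (Fin (n + 1)) (Fin (n + 1)) ℝ)
    (h1 : ∀ i : Fin n, M i.castSucc i.succ = 1)
    (h0 : ∀ i j : Fin n, i < j → M i.castSucc j.succ = 0) : n ≤ M.rank := by
  have hdet : (M.submatrix Fin.castSucc Fin.succ).det = 1 := by
    have htri : (M.submatrix Fin.castSucc Fin.succ).IsLowerTriangular :=
      fun i j hij => h0 i j hij
    rw [Matrix.det_of_isLowerTriangular _ htri]
    simp [h1]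
  have hrank := Matrix.rank_of_isUnit (M.submatrix Fin.castSucc Fin.succ)
    ((Matrix.isUnit_iff_isUnit_det _).2 (by simp [hdet]))
  rw [Fintype.card_fin] at hrank
  exact hrank.ge.trans (Matrix.rank_submatrix_le _ _ _)

/-- Corollary: gc(P_n) ≥ n − 1. -/
theorem path_lower (n : ℕ) : n - 1 ≤ gcGraph (pathGraphFin n) := by
  classical
  rcases n with _ | n
  · simp
  unfold gcGraph gc
  apply le_csInf
  · refine exists_gcFeasible ?_ ?_
    · ext i j
      simp [SimpleGraph.adj_comm]
    · simp
  · intro m hm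
    obtain ⟨d, hd⟩ := GCFeasible.exists_rank_le hm
    refine le_trans ?_ hd
    apply le_rank_of_submatrix_lowerTriangular
    · intro i
      have : i.castSucc ≠ i.succ := by simp [Fin.ext_iff]
      simp [pathGraphFin, this]
    · intro i j hij
      rw [Fin.lt_def] at hij
      have : i.castSucc ≠ j.succ := by
        simp only [ne_eq, Fin.ext_iff, Fin.val_castSucc, Fin.val_succ]
        omega
      simp only [pathGraphFin, Matrix.add_apply, Matrix.of_apply, SimpleGraph.fromRel_adj,
        Fin.val_castSucc, Fin.val_succ, Matrix.smul_apply, Matrix.one_apply_ne this]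
      rw [if_neg (by omega)]
      simp
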